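/- There exists a computable real X : ℕ → Bool which is Martin-Löf BP random and such that the limit lim_{n→∞} card(X ∩ [[n]])/n does not exist. -/

import Mathlib

namespace BP



/-- The finite binary string `(X 0, …, X (n−1))`. -/
def take (X : ℕ → Bool) (n : ℕ) : List Bool := (List.range n).map X

/-- `X ∈ [G]`: the real `X` extends some string of the finite set (list) `G`. -/
def Mem (X : ℕ → Bool) (G : List (List Bool)) : Prop :=
  ∃ τ ∈ G, take X τ.length = τ

/-- The maximum length of a string in `G`. -/
def maxLen (G : List (List Bool)) : ℕ := (G.map List.length).foldr max 0

/-- The list of all binary strings of length `L`. -/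
def allStrings (L : ℕ) : List (List Bool) :=
  (List.range (2 ^ L)).map fun k => (List.range L).map fun i => k.testBit i

/-- The uniform (fair-coin) measure of the clopen set `[G]`, computed by counting
which strings of length `maxLen G` extend a member of `G`. -/
def mu (G : List (List Bool)) : ℚ :=
  (((allStrings (maxLen G)).filter fun σ => G.any fun τ => decide (τ <+: σ)).length : ℚ)
    / 2 ^ maxLen G

/-- The uniform measure of `[G] ∩ [τ]`. -/
def muCap (G : List (List Bool)) (τ : List Bool) : ℚ :=
  (((allStrings (max (maxLen G) τ.length)).filter fun σ =>
      decide (τ <+: σ) && (G.any fun ρ => decide (ρ <+: σ))).length : ℚ)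
    / 2 ^ max (maxLen G) τ.length

/-- A primitive recursive test: a primitive recursive sequence of finite sets of
binary strings with `μ([Gₙ]) ≤ 2⁻ⁿ`. -/
def IsTest (G : ℕ → List (List Bool)) : Prop :=
  Primrec G ∧ ∀ n, mu (G n) ≤ ((2 : ℚ) ^ n)⁻¹

/-- `X` is Martin-Löf BP random. -/
def MLBPRandom (X : ℕ → Bool) : Prop :=
  ∀ G : ℕ → List (List Bool), IsTest G → ∃ n, ¬ Mem X (G n)

/-- A weak primitive recursive test. -/
def IsWeakTest (G : ℕ → List (List Bool)) : Prop :=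
  IsTest G ∧ ∃ ℓ : ℕ → ℕ, Primrec ℓ ∧ (∀ n, ∀ τ ∈ G n, τ.length = ℓ n) ∧
    ∀ n, ∀ τ ∈ G n, muCap (G (n + 1)) τ ≤ (1 / 2) * ((2 : ℚ) ^ τ.length)⁻¹

/-- A martingale with values in the nonnegative rationals. -/
def IsMartingale (d : List Bool → ℚ) : Prop :=
  d [] = 1 ∧ (∀ σ, 0 ≤ d σ) ∧
    ∀ σ, d σ = (d (σ ++ [false]) + d (σ ++ [true])) / 2

/-- The martingale `d` succeeds primitive recursively on `X`. -/
def SucceedsPR (d : List Bool → ℚ) (X : ℕ → Bool) : Prop :=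
  ∃ f : ℕ → ℕ, Primrec f ∧ ∀ n, (2 : ℚ) ^ n ≤ d (take X (f n))

/-- `X` is martingale BP random. -/
def MartingaleBPRandom (X : ℕ → Bool) : Prop :=
  ¬ ∃ d : List Bool → ℚ, Primrec d ∧ IsMartingale d ∧ SucceedsPR d X

/-- `X` is primitive recursively compressed by the machine `M`. -/
def CompressedBy (M : List Bool → List Bool) (X : ℕ → Bool) : Prop :=
  ∃ f : ℕ → ℕ, Primrec f ∧
    ∀ c, ∃ σ : List Bool, σ.length ≤ f c - c ∧ M σ = take X (f c)

/-- `X` is Kolmogorov BP random. -/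
def KolmogorovBPRandom (X : ℕ → Bool) : Prop :=
  ¬ ∃ M : List Bool → List Bool, Primrec M ∧ CompressedBy M X

/-- `M` is a (total) process machine: it is extension preserving. -/
def IsProcessMachine (M : List Bool → List Bool) : Prop :=
  ∀ σ τ : List Bool, σ <+: τ → M σ <+: M τ

/-- `M` is a quick process BP machine. -/
def IsQuickProcessBP (M : List Bool → List Bool) : Prop :=
  Primrec M ∧ IsProcessMachine M ∧
    ∃ h : ℕ → ℕ, Primrec h ∧ Monotone h ∧ (∀ k, ∃ n, k ≤ h n) ∧
      ∀ τ : List Bool, h τ.length ≤ (M τ).length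

/-- `X` is quick process BP random. -/
def QuickProcessBPRandom (X : ℕ → Bool) : Prop :=
  ¬ ∃ M : List Bool → List Bool, IsQuickProcessBP M ∧ CompressedBy M X

/-- The number of `i < n` with `X i = true`. -/
def cardBelow (X : ℕ → Bool) (n : ℕ) : ℕ := (List.range n).countP X




section Enumeration

open Nat.Partrec (Code)

/-- The code uses no unbounded search. -/
def searchFree : Code → Bool
  | .zero => true
  | .succ => true
  | .left => true
  | .right => true
  | .pair cf cg => searchFree cf && searchFree cg
  | .comp cf cg => searchFree cf && searchFree cg
  | .prec cf cg => searchFree cf && searchFree cg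
  | .rfind' _ => false

theorem computable_searchFree : Computable searchFree := by
  have hand : Computable₂ (fun (_ : Code) (x : Code × Code × Bool × Bool) => x.2.2.1 && x.2.2.2) :=
    (Primrec.and.comp (Primrec.fst.comp (Primrec.snd.comp (Primrec.snd.comp Primrec.snd)))
      (Primrec.snd.comp (Primrec.snd.comp (Primrec.snd.comp Primrec.snd)))).to_comp
  refine (Code.computable_recOn (c := fun c : Code => c) .id
    (z := fun _ => true) (.const _) (s := fun _ => true) (.const _)
    (l := fun _ => true) (.const _) (r := fun _ => true) (.const _)
    hand hand hand (rf := fun _ _ => false) (Computable.const _).to₂).of_eq fun c => ?_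
  induction c <;> simp_all [searchFree]

theorem eval_dom_of_searchFree {c : Code} (hc : searchFree c = true) (n : ℕ) :
    (c.eval n).Dom := by
  induction c generalizing n with
  | zero => trivial
  | succ => trivial
  | left => trivial
  | right => trivial
  | pair cf cg hf hg =>
    simp only [searchFree, Bool.and_eq_true] at hc
    simp [Code.eval, Seq.seq, hf hc.1, hg hc.2]
  | comp cf cg hf hg =>
    simp only [searchFree, Bool.and_eq_true] at hc
    exact Part.bind_dom.2 ⟨hg hc.2 n, hf hc.1 _⟩
  | prec cf cg hf hg =>
    simp only [searchFree, Bool.and_eq_true] at hc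
    obtain ⟨a, k, rfl⟩ : ∃ a k, n = Nat.pair a k := ⟨_, _, (Nat.pair_unpair n).symm⟩
    induction k with
    | zero => simpa using hf hc.1 a
    | succ k ih =>
      rw [Code.eval_prec_succ]
      simp [ih, hg hc.2]
  | rfind' cf _ => simp [searchFree] at hc

theorem exists_searchFree_code {f : ℕ → ℕ} (hf : Nat.Primrec f) :
    ∃ c : Code, searchFree c = true ∧ ∀ n, c.eval n = Part.some (f n) := by
  induction hf with
  | zero => exact ⟨.zero, rfl, fun _ => rfl⟩
  | succ => exact ⟨.succ, rfl, fun _ => rfl⟩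
  | left => exact ⟨.left, rfl, fun _ => rfl⟩
  | right => exact ⟨.right, rfl, fun _ => rfl⟩
  | pair _ _ hf hg =>
    obtain ⟨cf, hf, hf'⟩ := hf
    obtain ⟨cg, hg, hg'⟩ := hg
    exact ⟨.pair cf cg, by simp [searchFree, hf, hg],
      fun n => by simp [Code.eval, hf', hg', Seq.seq]⟩
  | comp _ _ hf hg =>
    obtain ⟨cf, hf, hf'⟩ := hf
    obtain ⟨cg, hg, hg'⟩ := hg
    refine ⟨.comp cf cg, by simp [searchFree, hf, hg], fun n => ?_⟩
    change (cg.eval n).bind (fun m => cf.eval m) = _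
    simp only [hg', hf', Part.bind_some]
  | prec _ _ hf hg =>
    obtain ⟨cf, hf, hf'⟩ := hf
    obtain ⟨cg, hg, hg'⟩ := hg
    refine ⟨.prec cf cg, by simp [searchFree, hf, hg], fun n => ?_⟩
    obtain ⟨a, k, rfl⟩ : ∃ a k, n = Nat.pair a k := ⟨_, _, (Nat.pair_unpair n).symm⟩
    induction k with
    | zero => simp [hf']
    | succ k ih => rw [Code.eval_prec_succ, ih]; simp [hg']

/-- There is a computable function enumerating all primitive recursive functions. -/
theorem exists_computable_enum_primrec :
    ∃ u : ℕ → ℕ → ℕ, Computable₂ u ∧ ∀ f : ℕ → ℕ, Primrec f → ∃ e, ∀ n, u e n = f n := by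
  classical
  let u : Code → ℕ → ℕ := fun c n =>
    if h : searchFree c = true then (c.eval n).get (eval_dom_of_searchFree h n) else 0
  have hu : Computable₂ u := by
    have h : Partrec fun p : Code × ℕ =>
        bif searchFree p.1 then p.1.eval p.2 else Part.some 0 :=
      Partrec.cond (computable_searchFree.comp .fst)
        (Code.eval_part.comp .fst .snd) (Computable.const 0).partrec
    refine h.of_eq_tot fun p => ?_
    by_cases hp : searchFree p.1 = true
    · simp [u, hp, Part.get_mem]
    · simp [u, hp]
  refine ⟨fun e => u (Denumerable.ofNat Code e), hu.comp ((Computable.ofNat Code).comp .fst) .snd,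
    fun f hf => ?_⟩
  obtain ⟨c, hc, hcf⟩ := exists_searchFree_code (Primrec.nat_iff.1 hf)
  exact ⟨Encodable.encode c, fun n => by simp [u, hc, hcf]⟩

/-- There is a computable enumeration of the primitive recursive sequences in `α`. -/
theorem exists_computable_enum_primrec_seq {α : Type*} [Primcodable α] [Inhabited α] :
    ∃ u : ℕ → ℕ → α, Computable₂ u ∧ ∀ f : ℕ → α, Primrec f → ∃ e, ∀ n, u e n = f n := by
  obtain ⟨u, hu, h⟩ := exists_computable_enum_primrec
  refine ⟨fun e n => (Encodable.decode (u e n)).getD default,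
    Computable.option_getD (Computable.decode.comp hu) (.const _), fun f hf => ?_⟩
  obtain ⟨e, he⟩ := h _ (Primrec.encode.comp hf)
  exact ⟨e, fun n => by simp [he]⟩

end Enumeration

theorem mem_allStrings {L : ℕ} {w : List Bool} : w ∈ allStrings L ↔ w.length = L := by
  simp only [allStrings, List.mem_map, List.mem_range]
  constructor
  · rintro ⟨k, -, rfl⟩; simp
  · rintro rfl
    refine ⟨Nat.ofBits fun i : Fin w.length => w[i], Nat.ofBits_lt_two_pow _, ?_⟩
    refine List.ext_getElem (by simp) fun i h₁ h₂ => ?_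
    simp [h₂]

theorem nodup_allStrings (L : ℕ) : (allStrings L).Nodup := by
  refine List.Nodup.map_on (fun x hx y hy h => ?_) List.nodup_range
  simp only [List.mem_range] at hx hy
  refine Nat.eq_of_testBit_eq fun i => ?_
  by_cases hi : i < L
  · exact List.map_inj_left.1 h i (List.mem_range.2 hi)
  · have := Nat.pow_le_pow_right two_pos (not_lt.1 hi)
    rw [Nat.testBit_lt_two_pow (hx.trans_le this), Nat.testBit_lt_two_pow (hy.trans_le this)]

theorem length_allStrings (L : ℕ) : (allStrings L).length = 2 ^ L := by
  simp [allStrings]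

theorem length_le_maxLen {G : List (List Bool)} {ρ : List Bool} (h : ρ ∈ G) :
    ρ.length ≤ maxLen G := by
  induction G with
  | nil => simp at h
  | cons a G ih =>
    simp only [maxLen, List.map_cons, List.foldr_cons] at ih ⊢
    rcases List.mem_cons.1 h with rfl | h
    · exact le_max_left _ _
    · exact (ih h).trans (le_max_right _ _)

/-- No string of `G` is a prefix of `τ`. -/
def Avoids (τ : List Bool) (G : List (List Bool)) : Prop := ∀ ρ ∈ G, ¬ ρ <+: τ

instance : DecidableRel Avoids := fun τ G => inferInstanceAs (Decidable (∀ ρ ∈ G, ¬ ρ <+: τ))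

/-- If every extension of `σ` of length `σ.length + maxLen G` meets `G`, then `[σ] ⊆ [G]`. -/
theorem inv_two_pow_le_mu {G : List (List Bool)} {σ : List Bool}
    (h : ∀ w : List Bool, w.length = maxLen G → ¬ Avoids (σ ++ w) G) :
    ((2 : ℚ) ^ σ.length)⁻¹ ≤ mu G := by
  set M := maxLen G
  have hsub : (allStrings (M - σ.length)).map (fun v => (σ ++ v).take M) ⊆
      (allStrings M).filter fun τ => G.any fun ρ => decide (ρ <+: τ) := by
    intro τ hτ
    obtain ⟨v, hv, rfl⟩ := List.mem_map.1 hτ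
    rw [mem_allStrings] at hv
    simp only [List.mem_filter, mem_allStrings, List.any_eq_true, decide_eq_true_eq]
    refine ⟨by simp; omega, ?_⟩
    have := h (v ++ List.replicate (M - v.length) false) (by simp; omega)
    simp only [Avoids, not_forall, not_not] at this
    obtain ⟨ρ, hρ, hp⟩ := this
    refine ⟨ρ, hρ, ?_⟩
    have hM : ρ.length ≤ M := length_le_maxLen hρ
    rw [← List.append_assoc] at hp
    refine List.prefix_of_prefix_length_le hp
      ((List.take_prefix _ _).trans (List.prefix_append _ _)) ?_
    simp; omega
  have hnodup : ((allStrings (M - σ.length)).map (fun v => (σ ++ v).take M)).Nodup := by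
    refine List.Nodup.map_on (fun v hv w hw hvw => ?_) (nodup_allStrings _)
    rw [mem_allStrings] at hv hw
    rcases le_total M σ.length with hM | hM
    · rw [Nat.sub_eq_zero_of_le hM] at hv hw
      rw [List.length_eq_zero_iff.1 hv, List.length_eq_zero_iff.1 hw]
    · rw [List.take_of_length_le (by simp; omega), List.take_of_length_le (by simp; omega)] at hvw
      exact List.append_cancel_left hvw
  have hcard := (hnodup.subperm hsub).length_le
  rw [List.length_map, length_allStrings] at hcard
  have hpow : (2 : ℚ) ^ M ≤ 2 ^ (M - σ.length) * 2 ^ σ.length := by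
    rw [← pow_add]
    exact pow_le_pow_right₀ one_le_two (by omega)
  have hcard' : (2 : ℚ) ^ (M - σ.length) ≤ (((allStrings M).filter fun τ =>
      G.any fun ρ => decide (ρ <+: τ)).length : ℚ) := by exact_mod_cast hcard
  rw [mu, inv_eq_one_div, div_le_div_iff₀ (by positivity) (by positivity), one_mul]
  exact hpow.trans (mul_le_mul_of_nonneg_right hcard' (by positivity))

/-- The first string `w` of length `maxLen G` such that `σ ++ w` avoids `G`, if there is one. -/
def escape (G : List (List Bool)) (σ : List Bool) : List Bool :=
  ((allStrings (maxLen G)).filter fun w => Avoids (σ ++ w) G).headI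

theorem escape_spec {G : List (List Bool)} {σ : List Bool}
    (h : mu G < ((2 : ℚ) ^ σ.length)⁻¹) :
    maxLen G ≤ (σ ++ escape G σ).length ∧ Avoids (σ ++ escape G σ) G := by
  have : ∃ w : List Bool, w.length = maxLen G ∧ Avoids (σ ++ w) G := by
    by_contra! hw
    exact absurd (inv_two_pow_le_mu hw) (not_le.2 h)
  obtain ⟨w, hw, hav⟩ := this
  have hmem : escape G σ ∈ (allStrings (maxLen G)).filter fun w => Avoids (σ ++ w) G := by
    have hne : ((allStrings (maxLen G)).filter fun w => Avoids (σ ++ w) G) ≠ [] :=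
      List.ne_nil_of_mem (List.mem_filter.2 ⟨mem_allStrings.2 hw, by simpa using hav⟩)
    rw [escape]
    cases hl : (allStrings (maxLen G)).filter fun w => Avoids (σ ++ w) G with
    | nil => exact absurd hl hne
    | cons a l => simp
  simp only [List.mem_filter, mem_allStrings, decide_eq_true_eq] at hmem
  exact ⟨by simp [hmem.1], hmem.2⟩

theorem not_mem_of_avoids {X : ℕ → Bool} {G : List (List Bool)} {n : ℕ} (hn : maxLen G ≤ n)
    (h : Avoids (take X n) G) : ¬ Mem X G := by
  rintro ⟨ρ, hρ, hX⟩
  refine h ρ hρ ?_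
  rw [← hX, take, take]
  refine List.IsPrefix.map _ ?_
  rw [List.prefix_iff_eq_take, List.take_range]
  simp [(length_le_maxLen hρ).trans hn]

/-- Avoid `G`, then append sufficiently many copies of `b` to force the frequency of `b`. -/
def extend (b : Bool) (G : List (List Bool)) (σ : List Bool) : List Bool :=
  (σ ++ escape G σ ++ [false]) ++
    List.replicate (2 * (σ ++ escape G σ ++ [false]).length) b

theorem prefix_extend (b : Bool) (G : List (List Bool)) (σ : List Bool) :
    σ ++ escape G σ <+: extend b G σ := by
  simp only [extend, List.append_assoc]
  rw [← List.append_assoc σ]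
  exact List.prefix_append _ _

theorem length_lt_length_extend (b : Bool) (G : List (List Bool)) (σ : List Bool) :
    σ.length < (extend b G σ).length := by
  simp [extend]

theorem count_extend_true (G : List (List Bool)) (σ : List Bool) :
    2 * (extend true G σ).length ≤ 3 * (extend true G σ).count true := by
  simp [extend]; omega

theorem count_extend_false (G : List (List Bool)) (σ : List Bool) :
    3 * (extend false G σ).count true ≤ (extend false G σ).length := by
  have h₁ := List.count_le_length (a := true) (l := σ)
  have h₂ := List.count_le_length (a := true) (l := escape G σ)
  simp [extend, List.count_replicate]; omega

theorem primrec_allStrings : Primrec allStrings := by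
  have hpow : Primrec fun n : ℕ => 2 ^ n := by
    refine (Primrec.nat_rec₁ (f := fun _ m => m * 2) 1
      (Primrec.nat_mul.comp .snd (.const 2)).to₂).of_eq fun n => ?_
    induction n with
    | zero => rfl
    | succ n ih => simp [ih, pow_succ]
  have hbit : Primrec₂ Nat.testBit := by
    refine (Primrec.beq.comp (Primrec.nat_mod.comp (Primrec.nat_div.comp .fst
      (hpow.comp .snd)) (.const 2)) (.const 1)).of_eq fun p => ?_
    rw [Nat.testBit_eq_decide_div_mod_eq]
    rfl
  exact Primrec.list_map (Primrec.list_range.comp hpow) (Primrec.list_map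
    (Primrec.list_range.comp .fst) (hbit.comp (Primrec.snd.comp .fst) .snd).to₂).to₂

theorem primrec_maxLen : Primrec maxLen :=
  Primrec.list_foldr (Primrec.list_map .id (Primrec.list_length.comp .snd).to₂) (.const 0)
    (Primrec.nat_max.comp (Primrec.fst.comp .snd) (Primrec.snd.comp .snd)).to₂

theorem primrecRel_avoids : PrimrecRel Avoids := by
  have hp : PrimrecRel fun ρ τ : List Bool => ¬ ρ <+: τ :=
    (PrimrecPred.not (Primrec.eq.comp (Primrec.list_take.comp
      (Primrec.list_length.comp .fst) .snd) .fst)).of_eq fun p => by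
        simp only [List.prefix_iff_eq_take (l₁ := p.1), eq_comm]
  exact hp.forall_mem_list.comp .snd .fst

theorem primrec_escape : Primrec₂ escape := by
  have hR : PrimrecRel fun (w : List Bool) (p : List (List Bool) × List Bool) =>
      Avoids (p.2 ++ w) p.1 :=
    primrecRel_avoids.comp (Primrec.list_append.comp (Primrec.snd.comp .snd) .fst)
      (Primrec.fst.comp .snd)
  exact Primrec.list_headI.comp (hR.listFilter.comp
    (primrec_allStrings.comp (primrec_maxLen.comp .fst)) .id)

theorem primrec_extend :
    Primrec fun p : Bool × List (List Bool) × List Bool => extend p.1 p.2.1 p.2.2 := by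
  have hτ : Primrec fun p : Bool × List (List Bool) × List Bool =>
      p.2.2 ++ escape p.2.1 p.2.2 ++ [false] :=
    Primrec.list_append.comp (Primrec.list_append.comp (Primrec.snd.comp .snd)
      (primrec_escape.comp (Primrec.fst.comp .snd) (Primrec.snd.comp .snd))) (.const _)
  refine (Primrec.list_append.comp hτ (Primrec.list_map (Primrec.list_range.comp
    (Primrec.nat_mul.comp (.const 2) (Primrec.list_length.comp hτ)))
    (Primrec.fst.comp .fst).to₂)).of_eq fun p => ?_
  simp [extend, List.map_const']

/-- Successive extensions, the `e`-th of which escapes from `u e n` for some large `n`. -/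
def stage (u : ℕ → ℕ → List (List Bool)) : ℕ → List Bool
  | 0 => []
  | e + 1 => extend e.bodd (u e ((stage u e).length + 1)) (stage u e)

/-- The limit of the strings `stage u e`. -/
def limitReal (u : ℕ → ℕ → List (List Bool)) (i : ℕ) : Bool := (stage u (i + 1)).getD i false

section Limit

variable {u : ℕ → ℕ → List (List Bool)}

theorem computable_stage (hu : Computable₂ u) : Computable (stage u) := by
  have he : Computable fun q : ℕ × ℕ × List Bool => q.2.1 := Computable.fst.comp .snd
  have hσ : Computable fun q : ℕ × ℕ × List Bool => q.2.2 := Computable.snd.comp .snd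
  have hG : Computable fun q : ℕ × ℕ × List Bool => u q.2.1 (q.2.2.length + 1) :=
    hu.comp he (Computable.succ.comp (Computable.list_length.comp hσ))
  have hb : Computable fun q : ℕ × ℕ × List Bool => q.2.1.bodd := Computable.nat_bodd.comp he
  have hstep : Computable₂ fun (_ : ℕ) (p : ℕ × List Bool) =>
      extend p.1.bodd (u p.1 (p.2.length + 1)) p.2 :=
    (primrec_extend.to_comp.comp (hb.pair (hG.pair hσ))).to₂
  refine (Computable.nat_rec .id (.const []) hstep).of_eq fun n => ?_
  induction n with
  | zero => rfl
  | succ n ih => exact congrArg (fun σ => extend n.bodd (u n (σ.length + 1)) σ) ih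

theorem computable_limitReal (hu : Computable₂ u) : Computable (limitReal u) :=
  (Primrec.list_getD false).to_comp.comp ((computable_stage hu).comp Computable.succ) .id

theorem stage_prefix_stage {e e' : ℕ} (h : e ≤ e') : stage u e <+: stage u e' := by
  induction e', h using Nat.le_induction with
  | base => exact List.prefix_rfl
  | succ n _ ih =>
    exact ih.trans ((List.prefix_append _ _).trans (prefix_extend n.bodd _ _))

theorem strictMono_length_stage : StrictMono fun e => (stage u e).length :=
  strictMono_nat_of_lt_succ fun _ => length_lt_length_extend _ _ _

theorem take_limitReal (e : ℕ) : take (limitReal u) (stage u e).length = stage u e := by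
  refine List.ext_getElem (by simp [take]) fun i h₁ h₂ => ?_
  have hi : i < (stage u (i + 1)).length := strictMono_length_stage.le_apply (x := i + 1)
  simp only [take, List.getElem_map, List.getElem_range, limitReal, List.getD_eq_getElem _ _ hi]
  rcases le_total e (i + 1) with h | h
  · exact ((stage_prefix_stage h).getElem h₂).symm
  · exact (stage_prefix_stage h).getElem hi

theorem take_limitReal_eq_of_isPrefix {e : ℕ} {τ : List Bool} (h : τ <+: stage u e) :
    take (limitReal u) τ.length = τ := by
  have := take_limitReal (u := u) e
  rw [List.prefix_iff_eq_take.1 h, ← this]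
  simp [take, ← List.map_take, List.take_range]

theorem cardBelow_limitReal (e : ℕ) :
    cardBelow (limitReal u) (stage u e).length = (stage u e).count true := by
  conv_rhs => rw [← take_limitReal (u := u) e]
  simp [cardBelow, take, List.count, List.countP_map, Function.comp_def]

theorem mlbpRandom_limitReal
    (hu : ∀ G : ℕ → List (List Bool), Primrec G → ∃ e, ∀ n, u e n = G n) :
    MLBPRandom (limitReal u) := by
  rintro G ⟨hG, hmu⟩
  obtain ⟨e, he⟩ := hu G hG
  have hlt : mu (G ((stage u e).length + 1)) < ((2 : ℚ) ^ (stage u e).length)⁻¹ := by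
    refine (hmu _).trans_lt (inv_strictAnti₀ (by positivity) ?_)
    exact pow_lt_pow_right₀ one_lt_two (Nat.lt_succ_self _)
  obtain ⟨hlen, hav⟩ := escape_spec hlt
  refine ⟨_, not_mem_of_avoids hlen ?_⟩
  rwa [take_limitReal_eq_of_isPrefix (e := e + 1)]
  rw [stage, he]
  exact prefix_extend _ _ _

theorem not_tendsto_density_limitReal :
    ¬ ∃ L : ℝ, Filter.Tendsto (fun n => (cardBelow (limitReal u) n : ℝ) / (n : ℝ))
      Filter.atTop (nhds L) := by
  rintro ⟨L, hL⟩
  have hlim {k : ℕ → ℕ} (hk : StrictMono k) :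
      Filter.Tendsto (fun e => ((stage u (k e)).count true : ℝ) / ((stage u (k e)).length : ℝ))
        Filter.atTop (nhds L) := by
    simpa only [Function.comp_def, cardBelow_limitReal] using
      hL.comp ((strictMono_length_stage (u := u)).comp hk).tendsto_atTop
  have hpos (e : ℕ) : (0 : ℝ) < (stage u (e + 1)).length := by
    exact_mod_cast (Nat.zero_le _).trans_lt (strictMono_length_stage (u := u) e.lt_succ_self)
  have hlow : L ≤ 1 / 3 := by
    refine le_of_tendsto' (hlim (k := fun e => 2 * e + 1) fun a b h => by simp; omega) fun e => ?_
    have := count_extend_false (u (2 * e) ((stage u (2 * e)).length + 1)) (stage u (2 * e))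
    rw [show false = (2 * e).bodd by simp, ← stage] at this
    rw [div_le_div_iff₀ (hpos _) (by norm_num)]
    have : (3 * (stage u (2 * e + 1)).count true : ℝ) ≤ (stage u (2 * e + 1)).length := by
      exact_mod_cast this
    linarith
  have hhigh : 2 / 3 ≤ L := by
    refine ge_of_tendsto' (hlim (k := fun e => 2 * e + 1 + 1) fun a b h => by simp; omega)
      fun e => ?_
    have := count_extend_true (u (2 * e + 1) ((stage u (2 * e + 1)).length + 1))
      (stage u (2 * e + 1))
    have hb : (2 * e + 1).bodd = true := by simp
    have hs : stage u (2 * e + 1 + 1) = extend true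
      (u (2 * e + 1) ((stage u (2 * e + 1)).length + 1)) (stage u (2 * e + 1)) := by
      rw [stage, hb]
    rw [← hs] at this
    rw [div_le_div_iff₀ (by norm_num) (hpos _)]
    have : (2 * (stage u (2 * e + 1 + 1)).length : ℝ) ≤
        3 * (stage u (2 * e + 1 + 1)).count true := by exact_mod_cast this
    linarith
  linarith

end Limit

theorem stmt11 :
    ∃ X : ℕ → Bool, Computable X ∧ MLBPRandom X ∧
      ¬ ∃ L : ℝ, Filter.Tendsto (fun n => (cardBelow X n : ℝ) / (n : ℝ))
        Filter.atTop (nhds L) := by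
  obtain ⟨u, hu, henum⟩ := exists_computable_enum_primrec_seq (α := List (List Bool))
  exact ⟨limitReal u, computable_limitReal hu, mlbpRandom_limitReal henum,
    not_tendsto_density_limitReal⟩

end BP
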